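/- Let w ∈ 𝒮_n and 1 ≤ k ≤ n. (i) If w_k = n, then ⟦w_1, …, w_{k−1}, n, w_{k+1}, …, w_n⟧ is isomorphic, as a chain complex, to the complex ⟦w_1, …, w_{k−1}, w_{k+1}, …, w_n⟧ (a weight summand of Λ^*𝔫𝔦𝔩_{n−1}) with degrees shifted up by n − k. (ii) If w_k = 1, then ⟦w_1, …, w_{k−1}, 1, w_{k+1}, …, w_n⟧ is isomorphic to ⟦w_1−1, …, w_{k−1}−1, w_{k+1}−1, …, w_n−1⟧ (a weight summand of Λ^*𝔫𝔦𝔩_{n−1}) with degrees shifted up by k − 1. -/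

import Mathlib

namespace Nil

/-- Index pairs `(a,b)` with `a < b` in `Fin n`, indexing the basis `e_{ab}` of `nil_n`. -/
abbrev P (n : ℕ) : Type := {p : Fin n × Fin n // p.1 < p.2}

/-- Lexicographic key of a pair. -/
def key {n : ℕ} (p : P n) : ℕ := p.1.1.1 * n + p.1.2.1

/-- Position (0-based) of `a` in the lexicographically sorted list of `M`. -/
def pos {n : ℕ} (M : Finset (P n)) (a : P n) : ℕ :=
  (M.filter fun b => key b < key a).card

/-- Basis of the degree `k` part of the Chevalley-Eilenberg complex `Λ^* nil_n`:
subsets `M` of pairs with `|M| = k` (empty for `k < 0`). -/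
abbrev B (n : ℕ) (k : ℤ) : Type := {M : Finset (P n) // (M.card : ℤ) = k}

/-- Degree `k` chain group of the Chevalley-Eilenberg complex of `nil_n`. -/
abbrev C (n : ℕ) (k : ℤ) : Type := B n k →₀ ℤ

/-- The Chevalley-Eilenberg boundary of a basis wedge `e_M`:
`∂(e_{a₁b₁} ∧ … ∧ e_{aₖbₖ}) = Σ_{i<j} (-1)^{i+j} [e_{aᵢbᵢ}, e_{aⱼbⱼ}] ∧ …` (omitting
the i-th and j-th factors), written in the lexicographically sorted basis.
For lexicographically sorted wedges the only nonzero brackets come from pairs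
`a = (x,y)`, `b = (y,z)`, producing `±e_{(x,z)}`. -/
noncomputable def dAux {n : ℕ} (k : ℤ) (M : Finset (P n)) : C n k :=
  ∑ a ∈ M, ∑ b ∈ M,
    if hab : a.1.2 = b.1.1 then
      (let c : P n := ⟨(a.1.1, b.1.2), lt_trans a.2 (by rw [hab]; exact b.2)⟩
       let M' : Finset (P n) := insert c ((M.erase a).erase b)
       if h' : (M'.card : ℤ) = k then
         ((-1 : ℤ) ^ (pos M a + pos M b + pos M' c)) • Finsupp.single (⟨M', h'⟩ : B n k) 1
       else 0)
    else 0

/-- The Chevalley-Eilenberg boundary map in degree `k+1`. -/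
noncomputable def d (n : ℕ) (k : ℤ) : C n (k + 1) →ₗ[ℤ] C n k :=
  Finsupp.lsum ℤ fun M => LinearMap.toSpanSingleton ℤ (C n k) (dAux k M.1)

/-- Degree-cast isomorphism. -/
noncomputable def castC (n : ℕ) {k l : ℤ} (h : k = l) : C n k ≃ₗ[ℤ] C n l :=
  Finsupp.domLCongr (Equiv.subtypeEquivRight fun _ => by rw [h])

/-- The boundary map out of degree `k`. -/
noncomputable def dFrom (n : ℕ) (k : ℤ) : C n k →ₗ[ℤ] C n (k - 1) :=
  (d n (k - 1)).comp (castC n (by ring : k = k - 1 + 1)).toLinearMap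

/-- Cycles of `Λ^* nil_n` in degree `k`. -/
noncomputable def Zfull (n : ℕ) (k : ℤ) : Submodule ℤ (C n k) := LinearMap.ker (dFrom n k)

noncomputable def HnilSub (n : ℕ) (k : ℤ) : Submodule ℤ (Zfull n k) :=
  Submodule.comap (Zfull n k).subtype (LinearMap.range (d n k) ⊓ Zfull n k)

/-- `H_k(nil_n; ℤ)`: the `k`-th integral homology of the Chevalley-Eilenberg complex
of the Lie ring of strictly upper triangular `n × n` integer matrices. -/
noncomputable def Hnil (n : ℕ) (k : ℤ) : Type := Zfull n k ⧸ HnilSub n k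

noncomputable instance (n : ℕ) (k : ℤ) : AddCommGroup (Hnil n k) :=
  inferInstanceAs (AddCommGroup (Zfull n k ⧸ HnilSub n k))

noncomputable instance (n : ℕ) (k : ℤ) : Module ℤ (Hnil n k) :=
  inferInstanceAs (Module ℤ (Zfull n k ⧸ HnilSub n k))

/-- The modified weight of a basis wedge `e_M` (indices of `Fin n` are 0-based, so the
`i`-th weight of the paper, `1 ≤ i ≤ n`, is `wt M ⟨i-1,_⟩`):
`w_i(e_M) = i - #{x : (x,i) ∈ M} + #{y : (i,y) ∈ M}`. -/
def wt {n : ℕ} (M : Finset (P n)) : Fin n → ℤ := fun i =>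
  ((i.1 : ℤ) + 1) - (M.filter fun p => p.1.2 = i).card + (M.filter fun p => p.1.1 = i).card

/-- Basis wedges of degree `k` and modified weight `w`. -/
abbrev Bw (n : ℕ) (k : ℤ) (w : Fin n → ℤ) : Type :=
  {M : Finset (P n) // (M.card : ℤ) = k ∧ wt M = w}

/-- Degree `k` part of the weight summand `⟦w⟧` of `Λ^* nil_n`. -/
abbrev Cw (n : ℕ) (k : ℤ) (w : Fin n → ℤ) : Type := Bw n k w →₀ ℤ

/-- Inclusion of the weight summand. -/
noncomputable def inclW (n : ℕ) (k : ℤ) (w : Fin n → ℤ) : Cw n k w →ₗ[ℤ] C n k :=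
  Finsupp.lmapDomain ℤ ℤ fun M => (⟨M.1, M.2.1⟩ : B n k)

/-- Projection onto the weight summand. -/
noncomputable def projW (n : ℕ) (k : ℤ) (w : Fin n → ℤ) : C n k →ₗ[ℤ] Cw n k w :=
  Finsupp.lsum ℤ fun M =>
    if h : wt M.1 = w then
      LinearMap.toSpanSingleton ℤ (Cw n k w) (Finsupp.single (⟨M.1, M.2, h⟩ : Bw n k w) 1)
    else 0

/-- The boundary of the weight summand `⟦w⟧` (the boundary preserves weights, so this
is the restriction of the Chevalley-Eilenberg boundary). -/
noncomputable def dW (n : ℕ) (k : ℤ) (w : Fin n → ℤ) : Cw n (k + 1) w →ₗ[ℤ] Cw n k w :=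
  (projW n k w) ∘ₗ (d n k) ∘ₗ (inclW n (k + 1) w)

noncomputable def castCw (n : ℕ) (w : Fin n → ℤ) {k l : ℤ} (h : k = l) :
    Cw n k w ≃ₗ[ℤ] Cw n l w :=
  Finsupp.domLCongr (Equiv.subtypeEquivRight fun _ => by rw [h])

noncomputable def dFromW (n : ℕ) (k : ℤ) (w : Fin n → ℤ) : Cw n k w →ₗ[ℤ] Cw n (k - 1) w :=
  (dW n (k - 1) w).comp (castCw n w (by ring : k = k - 1 + 1)).toLinearMap

noncomputable def ZW (n : ℕ) (k : ℤ) (w : Fin n → ℤ) : Submodule ℤ (Cw n k w) :=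
  LinearMap.ker (dFromW n k w)

noncomputable def HwSub (n : ℕ) (k : ℤ) (w : Fin n → ℤ) : Submodule ℤ (ZW n k w) :=
  Submodule.comap (ZW n k w).subtype (LinearMap.range (dW n k w) ⊓ ZW n k w)

/-- `H_k⟦w⟧`: the `k`-th homology of the weight summand `⟦w⟧` of `Λ^* nil_n`. -/
noncomputable def Hw (n : ℕ) (k : ℤ) (w : Fin n → ℤ) : Type := ZW n k w ⧸ HwSub n k w

noncomputable instance (n : ℕ) (k : ℤ) (w : Fin n → ℤ) : AddCommGroup (Hw n k w) :=
  inferInstanceAs (AddCommGroup (ZW n k w ⧸ HwSub n k w))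

noncomputable instance (n : ℕ) (k : ℤ) (w : Fin n → ℤ) : Module ℤ (Hw n k w) :=
  inferInstanceAs (Module ℤ (ZW n k w ⧸ HwSub n k w))

/-- `w ∈ 𝒮_n`: all entries lie in `{1,…,n}` and they add up to `binom (n+1) 2`. -/
def Sn (n : ℕ) (w : Fin n → ℤ) : Prop :=
  (∀ i, 1 ≤ w i ∧ w i ≤ (n : ℤ)) ∧ 2 * ∑ i, w i = (n : ℤ) * ((n : ℤ) + 1)

/-- Number of inversions of a permutation of `Fin n`. -/
def invCount (n : ℕ) (π : Equiv.Perm (Fin n)) : ℕ :=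
  (Finset.univ.filter fun p : Fin n × Fin n => p.1 < p.2 ∧ π p.2 < π p.1).card

/-- The weight sequence `(π(1), …, π(n))` attached to a permutation (1-based values). -/
def permWt (n : ℕ) (π : Equiv.Perm (Fin n)) : Fin n → ℤ := fun i => ((π i).1 : ℤ) + 1

/-- The set of inversions of a permutation, as a set of index pairs. -/
def invFinset {n : ℕ} (π : Equiv.Perm (Fin n)) : Finset (P n) :=
  Finset.univ.filter fun p => π p.1.2 < π p.1.1

/-- Index reversal `i ↦ n+1-i` (0-based: `i ↦ n-1-i`). -/
def rev {n : ℕ} (i : Fin n) : Fin n := ⟨n - 1 - i.1, by have := i.isLt; omega⟩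


/-- Deleting the `K`-th entry of a weight sequence. -/
def wdel {n : ℕ} (w : Fin n → ℤ) (K : Fin n) : Fin (n - 1) → ℤ := fun i =>
  if i.1 < K.1 then w ⟨i.1, by have := i.isLt; omega⟩
  else w ⟨i.1 + 1, by have := i.isLt; omega⟩

/-- The map on index pairs that skips the index `K`. -/
def skip {m : ℕ} (K : Fin (m + 1)) : P m ↪ P (m + 1) where
  toFun p := ⟨(K.succAbove p.1.1, K.succAbove p.1.2), Fin.succAbove_lt_succAbove_iff.2 p.2⟩
  inj' := by
    rintro ⟨⟨a, b⟩, h⟩ ⟨⟨a', b'⟩, h'⟩ hab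
    simpa using hab

@[simp] lemma skip_fst {m : ℕ} (K : Fin (m + 1)) (p : P m) :
    (skip K p).1.1 = K.succAbove p.1.1 := rfl

@[simp] lemma skip_snd {m : ℕ} (K : Fin (m + 1)) (p : P m) :
    (skip K p).1.2 = K.succAbove p.1.2 := rfl

/-- The composite pair `(x,z)` of `(x,y)` and `(y,z)`. -/
def comp {n : ℕ} (a b : P n) (hab : a.1.2 = b.1.1) : P n :=
  ⟨(a.1.1, b.1.2), lt_trans a.2 (by rw [hab]; exact b.2)⟩

/-- The index set obtained from `M` by replacing `a` and `b` by their composite. -/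
def merge {n : ℕ} (M : Finset (P n)) (a b : P n) (hab : a.1.2 = b.1.1) : Finset (P n) :=
  insert (comp a b hab) ((M.erase a).erase b)

/-- The basis wedge of `M` in `⟦w⟧` in degree `k`, or `0` if `M` has another degree or weight. -/
noncomputable def wedge {n : ℕ} (k : ℤ) (w : Fin n → ℤ) (M : Finset (P n)) : Cw n k w :=
  if h : (M.card : ℤ) = k ∧ wt M = w then Finsupp.single ⟨M, h⟩ 1 else 0

lemma wedge_eq_single {n : ℕ} {k : ℤ} {w : Fin n → ℤ} {M : Finset (P n)}
    (h : (M.card : ℤ) = k ∧ wt M = w) : wedge k w M = Finsupp.single ⟨M, h⟩ 1 := dif_pos h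

lemma dW_wedge {n : ℕ} {k : ℤ} {w : Fin n → ℤ} {M : Finset (P n)}
    (hM : (M.card : ℤ) = k + 1 ∧ wt M = w) :
    dW n k w (wedge (k + 1) w M) = ∑ a ∈ M, ∑ b ∈ M,
      if hab : a.1.2 = b.1.1 then
        ((-1 : ℤ) ^ (pos M a + pos M b + pos (merge M a b hab) (comp a b hab))) •
          wedge k w (merge M a b hab)
      else 0 := by
  have h1 : dW n k w (wedge (k + 1) w M) = projW n k w (dAux k M) := by
    simp [wedge_eq_single hM, dW, inclW, d]
  rw [h1, dAux, map_sum]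
  refine Finset.sum_congr rfl fun a _ => ?_
  rw [map_sum]
  refine Finset.sum_congr rfl fun b _ => ?_
  split_ifs with hab
  · change projW n k w (if h' : ((merge M a b hab).card : ℤ) = k then
      ((-1 : ℤ) ^ (pos M a + pos M b + pos (merge M a b hab) (comp a b hab))) •
        Finsupp.single (⟨merge M a b hab, h'⟩ : B n k) 1 else 0) = _
    unfold wedge
    by_cases h' : ((merge M a b hab).card : ℤ) = k
    · rw [dif_pos h', map_smul]
      congr 1
      by_cases hw : wt (merge M a b hab) = w <;> simp [projW, h', hw]
    · rw [dif_neg h', dif_neg (fun h => h' h.1), map_zero, smul_zero]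
  · exact map_zero _

lemma castCw_wedge {n : ℕ} {w : Fin n → ℤ} {k l : ℤ} (h : k = l) (M : Finset (P n)) :
    castCw n w h (wedge k w M) = wedge l w M := by
  subst h
  unfold wedge
  split_ifs
  · simp only [castCw, Finsupp.domLCongr_single]
    rfl
  · exact map_zero _

lemma ne_of_composable {n : ℕ} {a b : P n} (hab : a.1.2 = b.1.1) : a ≠ b := by
  rintro rfl
  exact absurd a.2 (by simp [hab])

lemma comp_ne_left {n : ℕ} {a b : P n} (hab : a.1.2 = b.1.1) : comp a b hab ≠ a := by
  intro h
  have h2 := congrArg (fun p : P n => p.1.2) h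
  change b.1.2 = a.1.2 at h2
  exact absurd b.2 (by simp [h2, hab])

lemma comp_ne_right {n : ℕ} {a b : P n} (hab : a.1.2 = b.1.1) : comp a b hab ≠ b := by
  intro h
  have h2 := congrArg (fun p : P n => p.1.1) h
  change a.1.1 = b.1.1 at h2
  exact absurd a.2 (by simp [h2, hab])

lemma card_erase_erase {n : ℕ} {M : Finset (P n)} {a b : P n} (ha : a ∈ M) (hb : b ∈ M)
    (hab : a ≠ b) : ((M.erase a).erase b).card + 2 = M.card := by
  have h1 := Finset.card_erase_add_one ha
  have h2 := Finset.card_erase_add_one (Finset.mem_erase.2 ⟨hab.symm, hb⟩)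
  omega

/-- A bracket landing on a factor that is already present contributes nothing. -/
lemma wedge_merge_eq_zero {n : ℕ} {k : ℤ} {w : Fin n → ℤ} {M : Finset (P n)}
    (hM : (M.card : ℤ) = k + 1) {a b : P n} (ha : a ∈ M) (hb : b ∈ M) (hab : a.1.2 = b.1.1)
    (hc : comp a b hab ∈ M) : wedge k w (merge M a b hab) = 0 := by
  refine dif_neg fun h => ?_
  have h1 := card_erase_erase ha hb (ne_of_composable hab)
  have h2 : comp a b hab ∈ (M.erase a).erase b := by
    simp [hc, comp_ne_left hab, comp_ne_right hab]
  have h3 := h.1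
  rw [merge, Finset.insert_eq_of_mem h2] at h3
  omega

lemma sum_merge {n : ℕ} {k : ℤ} {M : Finset (P n)} (hM : (M.card : ℤ) = k + 1) {a b : P n}
    (ha : a ∈ M) (hb : b ∈ M) (hab : a.1.2 = b.1.1) (hk : ((merge M a b hab).card : ℤ) = k)
    (f : P n → ℕ) :
    ∑ p ∈ merge M a b hab, f p + f a + f b = ∑ p ∈ M, f p + f (comp a b hab) := by
  have h1 := card_erase_erase ha hb (ne_of_composable hab)
  have h2 : comp a b hab ∉ (M.erase a).erase b := by
    intro h
    rw [merge, Finset.insert_eq_of_mem h] at hk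
    omega
  have h3 := Finset.add_sum_erase M f ha
  have h4 := Finset.add_sum_erase (M.erase a) f
    (Finset.mem_erase.2 ⟨(ne_of_composable hab).symm, hb⟩)
  rw [merge, Finset.sum_insert h2]
  omega

lemma key_lt_key_iff {n : ℕ} (p q : P n) :
    key p < key q ↔ p.1.1 < q.1.1 ∨ p.1.1 = q.1.1 ∧ p.1.2 < q.1.2 := by
  obtain ⟨⟨⟨a, ha⟩, ⟨b, hb⟩⟩, h⟩ := p
  obtain ⟨⟨⟨c, hc⟩, ⟨e, he⟩⟩, h'⟩ := q
  simp only [key, Fin.mk_lt_mk, Fin.mk.injEq]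
  rcases lt_trichotomy a c with hac | rfl | hac
  · have := Nat.mul_le_mul_right n hac
    rw [Nat.succ_mul] at this
    constructor
    · intro _; exact Or.inl hac
    · intro _; omega
  · simp
  · have := Nat.mul_le_mul_right n hac
    rw [Nat.succ_mul] at this
    constructor
    · intro _; omega
    · intro _; omega

section Extend

variable {m : ℕ} (K : Fin (m + 1)) (X : Finset (P (m + 1)))

/-- The set of pairs avoiding `K` given by `M`, together with the fixed set `X`. -/
def extend (M : Finset (P m)) : Finset (P (m + 1)) := X ∪ M.map (skip K)

/-- The number of elements of `X` that precede the image of `p`. -/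
def preceding (p : P m) : ℕ := (X.filter fun q => key q < key (skip K p)).card

/-- The sign of moving the factors of `X` to the front of the wedge `e_{extend K X M}`. -/
def shuffleSign (M : Finset (P m)) : ℤˣ := (-1) ^ ∑ p ∈ M, preceding K X p

variable {K X}

lemma key_skip_lt_iff (p q : P m) : key (skip K p) < key (skip K q) ↔ key p < key q := by
  rw [key_lt_key_iff, key_lt_key_iff]
  simp

lemma disjoint_map_skip (hX : ∀ p ∈ X, p.1.1 = K ∨ p.1.2 = K) (M : Finset (P m)) :
    Disjoint X (M.map (skip K)) := by
  rw [Finset.disjoint_left]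
  intro p hp hp'
  obtain ⟨q, -, rfl⟩ := Finset.mem_map.1 hp'
  rcases hX _ hp with h | h
  · exact Fin.succAbove_ne K _ h
  · exact Fin.succAbove_ne K _ h

lemma skip_notMem (hX : ∀ p ∈ X, p.1.1 = K ∨ p.1.2 = K) (p : P m) : skip K p ∉ X := by
  intro hp
  rcases hX _ hp with h | h
  · exact Fin.succAbove_ne K _ h
  · exact Fin.succAbove_ne K _ h

lemma skip_mem_extend (hX : ∀ p ∈ X, p.1.1 = K ∨ p.1.2 = K) (M : Finset (P m)) (p : P m) :
    skip K p ∈ extend K X M ↔ p ∈ M := by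
  simp [extend, skip_notMem hX]

lemma exists_skip_eq (p : P (m + 1)) (h1 : p.1.1 ≠ K) (h2 : p.1.2 ≠ K) : ∃ q, skip K q = p := by
  obtain ⟨⟨a, b⟩, h⟩ := p
  obtain ⟨a, rfl⟩ := Fin.exists_succAbove_eq h1
  obtain ⟨b, rfl⟩ := Fin.exists_succAbove_eq h2
  exact ⟨⟨(a, b), Fin.succAbove_lt_succAbove_iff.1 h⟩, rfl⟩

lemma card_extend (hX : ∀ p ∈ X, p.1.1 = K ∨ p.1.2 = K) (M : Finset (P m)) :
    (extend K X M).card = X.card + M.card := by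
  rw [extend, Finset.card_union_of_disjoint (disjoint_map_skip hX M), Finset.card_map]

lemma card_filter_extend (hX : ∀ p ∈ X, p.1.1 = K ∨ p.1.2 = K) (M : Finset (P m))
    (q : P (m + 1) → Prop) [DecidablePred q] :
    ((extend K X M).filter q).card =
      (X.filter q).card + (M.filter fun p => q (skip K p)).card := by
  rw [extend, Finset.filter_union, Finset.card_union_of_disjoint
    (Finset.disjoint_filter_filter (disjoint_map_skip hX M)), Finset.filter_map, Finset.card_map]
  rfl

lemma pos_extend (hX : ∀ p ∈ X, p.1.1 = K ∨ p.1.2 = K) (M : Finset (P m)) (p : P m) :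
    pos (extend K X M) (skip K p) = preceding K X p + pos M p := by
  rw [pos, card_filter_extend hX]
  simp only [key_skip_lt_iff]
  rfl

lemma skip_composable_iff (a b : P m) :
    (skip K a).1.2 = (skip K b).1.1 ↔ a.1.2 = b.1.1 := by
  simp

lemma merge_extend (hX : ∀ p ∈ X, p.1.1 = K ∨ p.1.2 = K) (M : Finset (P m)) (a b : P m)
    (hab : a.1.2 = b.1.1) :
    merge (extend K X M) (skip K a) (skip K b) ((skip_composable_iff a b).2 hab) =
      extend K X (merge M a b hab) := by
  have hc : comp (skip K a) (skip K b) ((skip_composable_iff a b).2 hab) =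
    skip K (comp a b hab) := rfl
  have ha := skip_notMem hX a
  have hb := skip_notMem hX b
  simp only [merge, hc, extend, Finset.map_insert, Finset.map_erase, Finset.union_insert,
    Finset.erase_union_distrib, Finset.erase_eq_of_notMem ha, Finset.erase_eq_of_notMem hb]

lemma extend_filter_skip {M : Finset (P (m + 1))}
    (hM : ∀ p : P (m + 1), p.1.1 = K ∨ p.1.2 = K → (p ∈ M ↔ p ∈ X))
    (hX : ∀ p ∈ X, p.1.1 = K ∨ p.1.2 = K) :
    extend K X (Finset.univ.filter fun p => skip K p ∈ M) = M := by
  ext p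
  by_cases hp : p.1.1 = K ∨ p.1.2 = K
  · rw [hM p hp]
    simp only [extend, Finset.mem_union, Finset.mem_map, Finset.mem_filter, Finset.mem_univ,
      true_and, or_iff_left_iff_imp]
    rintro ⟨q, hq, rfl⟩
    exact (hM _ hp).1 hq
  · push Not at hp
    obtain ⟨q, rfl⟩ := exists_skip_eq p hp.1 hp.2
    simp [skip_mem_extend hX]

/-- If `X` consists of pairs through `K` and absorbs brackets, and the basis wedges of weight `w`
are the extensions by `X` of those of weight `w'`, then `⟦w⟧` is `⟦w'⟧` shifted by `|X|`. -/
theorem exists_equiv_of_extend (hX : ∀ p ∈ X, p.1.1 = K ∨ p.1.2 = K)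
    (habsorb : ∀ a b (hab : a.1.2 = b.1.1), (a ∈ X ∨ ∃ p, skip K p = a) →
      (b ∈ X ∨ ∃ p, skip K p = b) → a ∈ X ∨ b ∈ X → comp a b hab ∈ X)
    {w : Fin (m + 1) → ℤ} {w' : Fin m → ℤ}
    (hwt : ∀ M, wt (extend K X M) = w ↔ wt M = w')
    (hsurj : ∀ M, wt M = w → ∀ p : P (m + 1), p.1.1 = K ∨ p.1.2 = K → (p ∈ M ↔ p ∈ X))
    {s : ℤ} (hs : (X.card : ℤ) = s) :
    ∃ e : (d : ℤ) → Cw (m + 1) d w ≃ₗ[ℤ] Cw m (d - s) w',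
      ∀ (d : ℤ) (hd : d + 1 - s = d - s + 1),
        dW m (d - s) w' ∘ₗ (castCw m w' hd).toLinearMap ∘ₗ (e (d + 1)).toLinearMap =
          (e d).toLinearMap ∘ₗ dW (m + 1) d w := by
  let σ (d : ℤ) : Bw m (d - s) w' ≃ Bw (m + 1) d w :=
    { toFun := fun M => ⟨extend K X M.1, by
        have := M.2.1
        rw [card_extend hX]; push_cast; omega, (hwt _).2 M.2.2⟩
      invFun := fun M => by
        have hM := extend_filter_skip (hsurj M.1 M.2.2) hX
        refine ⟨Finset.univ.filter fun p => skip K p ∈ M.1, ?_, (hwt _).1 (by rw [hM, M.2.2])⟩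
        have h1 := card_extend hX (Finset.univ.filter fun p => skip K p ∈ M.1)
        rw [hM] at h1
        have := M.2.1
        omega
      left_inv := fun M => by
        apply Subtype.ext
        ext p
        simp [skip_mem_extend hX]
      right_inv := fun M => Subtype.ext (extend_filter_skip (hsurj M.1 M.2.2) hX) }
  let e (d : ℤ) : Cw (m + 1) d w ≃ₗ[ℤ] Cw m (d - s) w' :=
    (Finsupp.basisSingleOne (R := ℤ)).equiv
      ((Finsupp.basisSingleOne (R := ℤ)).unitsSMul fun M : Bw m (d - s) w' =>
        shuffleSign K X M.1) (σ d).symm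
  have he (d : ℤ) (M : Finset (P m)) :
      e d (wedge d w (extend K X M)) = (shuffleSign K X M : ℤ) • wedge (d - s) w' M := by
    by_cases h : (M.card : ℤ) = d - s ∧ wt M = w'
    · have h1 : wedge d w (extend K X M) = Finsupp.basisSingleOne (R := ℤ) (σ d ⟨M, h⟩) := by
        rw [Finsupp.coe_basisSingleOne]
        exact wedge_eq_single (σ d ⟨M, h⟩).2
      rw [h1, Module.Basis.equiv_apply, Equiv.symm_apply_apply, Module.Basis.unitsSMul_apply,
        Finsupp.coe_basisSingleOne, wedge, dif_pos h]
      rfl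
    · have h1 : wedge d w (extend K X M) = 0 := by
        refine dif_neg fun h1 => h ⟨?_, (hwt _).1 h1.2⟩
        have := h1.1
        rw [card_extend hX] at this
        push_cast at this
        omega
      rw [h1, map_zero, wedge, dif_neg h, smul_zero]
  refine ⟨e, fun d hd => ?_⟩
  refine Finsupp.lhom_ext' fun M => LinearMap.ext_ring ?_
  obtain ⟨⟨M, hM⟩, rfl⟩ := (σ (d + 1)).surjective M
  have hcard : (M.card : ℤ) = d - s + 1 := by have := hM.1; omega
  have hcard' : ((extend K X M).card : ℤ) = d + 1 := by
    rw [card_extend hX]; push_cast; omega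
  simp only [LinearMap.comp_apply, Finsupp.lsingle_apply, LinearEquiv.coe_coe]
  have hext : ((extend K X M).card : ℤ) = d + 1 ∧ wt (extend K X M) = w :=
    ⟨hcard', (hwt M).2 hM.2⟩
  have hσ : Finsupp.single (σ (d + 1) ⟨M, hM⟩) (1 : ℤ) = wedge (d + 1) w (extend K X M) :=
    (wedge_eq_single hext).symm
  rw [hσ, dW_wedge hext, he, map_smul, map_smul, castCw_wedge, dW_wedge ⟨hcard, hM.2⟩, map_sum]
  have hmem (a) (ha : a ∈ extend K X M) : a ∈ X ∨ ∃ p, skip K p = a := by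
    rcases Finset.mem_union.1 ha with h | h
    · exact Or.inl h
    · obtain ⟨p, -, hp⟩ := Finset.mem_map.1 h
      exact Or.inr ⟨p, hp⟩
  have hsub : X ⊆ extend K X M := Finset.subset_union_left
  have hzero (a b) (ha : a ∈ extend K X M) (hb : b ∈ extend K X M) (h : a ∈ X ∨ b ∈ X)
      (hab : a.1.2 = b.1.1) : wedge d w (merge (extend K X M) a b hab) = 0 :=
    wedge_merge_eq_zero hcard' ha hb hab
      (hsub (habsorb a b hab (hmem a ha) (hmem b hb) h))
  have hsum (g : P (m + 1) → Cw m (d - s) w') (hg : ∀ a ∈ X, g a = 0) :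
      ∑ a ∈ extend K X M, g a = ∑ a ∈ M, g (skip K a) := by
    rw [extend, Finset.sum_union (disjoint_map_skip hX M), Finset.sum_eq_zero hg, zero_add,
      Finset.sum_map]
  rw [hsum, Finset.smul_sum]
  swap
  · intro a ha
    rw [Finset.sum_eq_zero, map_zero]
    intro b hb
    split_ifs with hab
    · rw [hzero a b (hsub ha) hb (Or.inl ha), smul_zero]
    · rfl
  refine Finset.sum_congr rfl fun a ha => ?_
  have ha' := (skip_mem_extend hX M a).2 ha
  rw [map_sum, hsum, Finset.smul_sum]
  swap
  · intro b hb
    split_ifs with hab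
    · rw [hzero _ b ha' (hsub hb) (Or.inr hb), smul_zero, map_zero]
    · exact map_zero _
  refine Finset.sum_congr rfl fun b hb => ?_
  by_cases hab : a.1.2 = b.1.1
  · rw [dif_pos hab, dif_pos ((skip_composable_iff a b).2 hab), map_smul]
    change _ = ((-1 : ℤ) ^ (pos (extend K X M) _ + pos (extend K X M) _ +
      pos (merge (extend K X M) _ _ _) (skip K (comp a b hab)))) • e d (wedge d w _)
    rw [merge_extend hX M a b hab, he, pos_extend hX, pos_extend hX, pos_extend hX]
    by_cases hk : ((merge M a b hab).card : ℤ) = d - s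
    · rw [smul_smul, smul_smul]
      congr 1
      have hp := sum_merge hcard ha hb hab hk (preceding K X)
      simp only [shuffleSign, Units.val_pow_eq_pow_val, Units.val_neg, Units.val_one, ← pow_add]
      apply neg_one_pow_congr
      simp only [Nat.even_iff]
      omega
    · rw [wedge, dif_neg fun h => hk h.1]
      simp only [smul_zero]
  · rw [dif_neg hab, dif_neg fun h => hab ((skip_composable_iff a b).1 h), smul_zero, map_zero]

end Extend

lemma wdel_eq {m : ℕ} (w : Fin (m + 1) → ℤ) (K : Fin (m + 1)) (j : Fin m) :
    wdel (n := m + 1) w K j = w (K.succAbove j) := by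
  unfold wdel
  split_ifs with h
  · rw [Fin.succAbove_of_castSucc_lt K j h]
    rfl
  · rw [Fin.succAbove_of_le_castSucc K j (not_lt.1 h)]
    rfl

lemma wt_extend_succAbove {m : ℕ} {K : Fin (m + 1)} {X : Finset (P (m + 1))}
    (hX : ∀ p ∈ X, p.1.1 = K ∨ p.1.2 = K) (M : Finset (P m)) (j : Fin m) :
    wt (extend K X M) (K.succAbove j) = wt M j + (if K < K.succAbove j then 1 else 0)
      - (X.filter fun p => p.1.2 = K.succAbove j).card
      + (X.filter fun p => p.1.1 = K.succAbove j).card := by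
  have hv : ((K.succAbove j : ℕ) : ℤ) = j + (if K < K.succAbove j then 1 else 0) := by
    split_ifs with h
    · rw [Fin.succAbove_of_le_castSucc K j (Fin.lt_succAbove_iff_le_castSucc K j |>.1 h)]
      simp
    · rw [Fin.lt_succAbove_iff_le_castSucc, not_le] at h
      rw [Fin.succAbove_of_castSucc_lt K j h]
      simp
  simp only [wt, card_filter_extend hX, hv]
  simp only [skip_fst, skip_snd, Fin.succAbove_right_inj]
  push_cast
  ring

lemma wt_extend_self {m : ℕ} {K : Fin (m + 1)} {X : Finset (P (m + 1))}
    (hX : ∀ p ∈ X, p.1.1 = K ∨ p.1.2 = K) (M : Finset (P m)) :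
    wt (extend K X M) K = (K.1 : ℤ) + 1 - (X.filter fun p => p.1.2 = K).card
      + (X.filter fun p => p.1.1 = K).card := by
  simp only [wt, card_filter_extend hX]
  simp [Fin.succAbove_ne]

lemma card_filter_fst {n : ℕ} (K : Fin n) :
    ((Finset.univ : Finset (P n)).filter fun p => p.1.1 = K).card = n - 1 - K.1 := by
  rw [← Fin.card_Ioi]
  refine Finset.card_bij (fun p _ => p.1.2) ?_ ?_ ?_
  · rintro ⟨⟨a, b⟩, h⟩ hp
    obtain rfl : a = K := by simpa using hp
    simpa using h
  · rintro ⟨⟨a, b⟩, h⟩ hp ⟨⟨a', b'⟩, h'⟩ hp' hb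
    simp_all
  · intro b hb
    exact ⟨⟨(K, b), by simpa using hb⟩, by simp, rfl⟩

lemma card_filter_snd {n : ℕ} (K : Fin n) :
    ((Finset.univ : Finset (P n)).filter fun p => p.1.2 = K).card = K.1 := by
  rw [← Fin.card_Iio]
  refine Finset.card_bij (fun p _ => p.1.1) ?_ ?_ ?_
  · rintro ⟨⟨a, b⟩, h⟩ hp
    obtain rfl : b = K := by simpa using hp
    simpa using h
  · rintro ⟨⟨a, b⟩, h⟩ hp ⟨⟨a', b'⟩, h'⟩ hp' hb
    simp_all
  · intro b hb
    exact ⟨⟨(b, K), by simpa using hb⟩, by simp, rfl⟩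

lemma card_filter_fst_snd {n : ℕ} (a b : Fin n) :
    ((Finset.univ : Finset (P n)).filter fun p => p.1.1 = a ∧ p.1.2 = b).card =
      if a < b then 1 else 0 := by
  split_ifs with h
  · rw [Finset.card_eq_one]
    refine ⟨⟨(a, b), h⟩, ?_⟩
    ext ⟨⟨x, y⟩, hp⟩
    simp
  · rw [Finset.card_eq_zero, Finset.filter_eq_empty_iff]
    rintro ⟨⟨x, y⟩, hp⟩ - ⟨rfl, rfl⟩
    exact h hp

lemma card_filter_snd_fst {n : ℕ} (a b : Fin n) :
    ((Finset.univ : Finset (P n)).filter fun p => p.1.2 = b ∧ p.1.1 = a).card =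
      if a < b then 1 else 0 := by
  rw [← card_filter_fst_snd]
  exact congrArg Finset.card (Finset.filter_congr fun p _ => and_comm)

lemma wt_eq_iff {m : ℕ} {K : Fin (m + 1)} {v w : Fin (m + 1) → ℤ} {u w' : Fin m → ℤ} {t : ℤ}
    (hK : v K = w K) (hv : ∀ j, v (K.succAbove j) = u j + t)
    (hw : ∀ j, w (K.succAbove j) = w' j + t) : v = w ↔ u = w' := by
  rw [funext_iff, funext_iff, Fin.forall_iff_succAbove K]
  simp [hK, hv, hw]

lemma filter_fst_card_le {n : ℕ} (M : Finset (P n)) (K : Fin n) :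
    (M.filter fun p => p.1.1 = K).card ≤ n - 1 - K.1 := by
  rw [← card_filter_fst]
  exact Finset.card_le_card (Finset.filter_subset_filter _ (Finset.subset_univ M))

lemma filter_snd_card_le {n : ℕ} (M : Finset (P n)) (K : Fin n) :
    (M.filter fun p => p.1.2 = K).card ≤ K.1 := by
  rw [← card_filter_snd]
  exact Finset.card_le_card (Finset.filter_subset_filter _ (Finset.subset_univ M))

/-- An entry of weight `n` forces all pairs `(K,y)` and no pair `(x,K)`. -/
lemma mem_iff_of_wt_eq_top {n : ℕ} {M : Finset (P n)} {K : Fin n} (h : wt M K = n) {p : P n}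
    (hp : p.1.1 = K ∨ p.1.2 = K) : p ∈ M ↔ p.1.1 = K := by
  have h1 := filter_fst_card_le M K
  have hK := K.isLt
  simp only [wt] at h
  have hfst : M.filter (fun p => p.1.1 = K) = Finset.univ.filter fun p => p.1.1 = K :=
    Finset.eq_of_subset_of_card_le (Finset.filter_subset_filter _ (Finset.subset_univ M))
      (by rw [card_filter_fst]; omega)
  have hsnd : M.filter (fun p => p.1.2 = K) = ∅ := Finset.card_eq_zero.1 (by omega)
  constructor
  · intro hpM
    refine hp.resolve_right fun h2 => ?_
    exact Finset.notMem_empty p (hsnd ▸ Finset.mem_filter.2 ⟨hpM, h2⟩)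
  · intro h2
    have : p ∈ M.filter (fun p => p.1.1 = K) := by rw [hfst]; simp [h2]
    exact (Finset.mem_filter.1 this).1

/-- An entry of weight `1` forces all pairs `(x,K)` and no pair `(K,y)`. -/
lemma mem_iff_of_wt_eq_one {n : ℕ} {M : Finset (P n)} {K : Fin n} (h : wt M K = 1) {p : P n}
    (hp : p.1.1 = K ∨ p.1.2 = K) : p ∈ M ↔ p.1.2 = K := by
  have h1 := filter_snd_card_le M K
  simp only [wt] at h
  have hsnd : M.filter (fun p => p.1.2 = K) = Finset.univ.filter fun p => p.1.2 = K :=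
    Finset.eq_of_subset_of_card_le (Finset.filter_subset_filter _ (Finset.subset_univ M))
      (by rw [card_filter_snd]; omega)
  have hfst : M.filter (fun p => p.1.1 = K) = ∅ := Finset.card_eq_zero.1 (by omega)
  constructor
  · intro hpM
    refine hp.resolve_left fun h2 => ?_
    exact Finset.notMem_empty p (hfst ▸ Finset.mem_filter.2 ⟨hpM, h2⟩)
  · intro h2
    have : p ∈ M.filter (fun p => p.1.2 = K) := by rw [hsnd]; simp [h2]
    exact (Finset.mem_filter.1 this).1

theorem exists_equiv_of_eq_top {m : ℕ} (w : Fin (m + 1) → ℤ) (K : Fin (m + 1))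
    (hK : w K = ((m + 1 : ℕ) : ℤ)) {s : ℤ} (hs : s = ((m + 1 : ℕ) : ℤ) - 1 - K.1) :
    ∃ e : (d : ℤ) → Cw (m + 1) d w ≃ₗ[ℤ] Cw m (d - s) (wdel (n := m + 1) w K),
      ∀ (d : ℤ) (hd : d + 1 - s = d - s + 1),
        dW m (d - s) (wdel (n := m + 1) w K) ∘ₗ
            (castCw m (wdel (n := m + 1) w K) hd).toLinearMap ∘ₗ (e (d + 1)).toLinearMap =
          (e d).toLinearMap ∘ₗ dW (m + 1) d w := by
  have hKlt := K.isLt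
  have hX : ∀ p ∈ (Finset.univ : Finset (P (m + 1))).filter (fun p => p.1.1 = K),
      p.1.1 = K ∨ p.1.2 = K := fun p hp => Or.inl (Finset.mem_filter.1 hp).2
  refine exists_equiv_of_extend (K := K) (X := Finset.univ.filter fun p => p.1.1 = K) hX
    ?_ ?_ ?_ ?_
  · intro a b hab ha _ h
    simp only [Finset.mem_filter, Finset.mem_univ, true_and] at ha h ⊢
    rcases h with h | h
    · exact h
    · rcases ha with ha | ⟨p, rfl⟩
      · exact ha
      · exact absurd (hab.trans h) (Fin.succAbove_ne K _)
  · intro M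
    refine wt_eq_iff (K := K) (t := 0) ?_ (fun j => ?_) (fun j => ?_)
    · rw [wt_extend_self hX, hK, Finset.filter_filter, Finset.filter_filter, card_filter_fst_snd]
      simp only [and_self, card_filter_fst, lt_irrefl, if_false]
      omega
    · rw [wt_extend_succAbove hX, Finset.filter_filter, Finset.filter_filter, card_filter_fst_snd,
        Finset.filter_false_of_mem fun p _ h =>
          Fin.succAbove_ne K j (h.2.symm.trans h.1)]
      simp
    · rw [wdel_eq, add_zero]
  · intro M hM p hp
    rw [mem_iff_of_wt_eq_top (by rw [hM, hK]) hp]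
    simp
  · rw [card_filter_fst]
    omega

theorem exists_equiv_of_eq_one {m : ℕ} (w : Fin (m + 1) → ℤ) (K : Fin (m + 1)) (hK : w K = 1) :
    ∃ e : (d : ℤ) → Cw (m + 1) d w ≃ₗ[ℤ] Cw m (d - K.1) (fun i => wdel (n := m + 1) w K i - 1),
      ∀ (d : ℤ) (hd : d + 1 - (K.1 : ℤ) = d - K.1 + 1),
        dW m (d - K.1) (fun i => wdel (n := m + 1) w K i - 1) ∘ₗ
            (castCw m (fun i => wdel (n := m + 1) w K i - 1) hd).toLinearMap ∘ₗ
            (e (d + 1)).toLinearMap =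
          (e d).toLinearMap ∘ₗ dW (m + 1) d w := by
  have hX : ∀ p ∈ (Finset.univ : Finset (P (m + 1))).filter (fun p => p.1.2 = K),
      p.1.1 = K ∨ p.1.2 = K := fun p hp => Or.inr (Finset.mem_filter.1 hp).2
  refine exists_equiv_of_extend (K := K) (X := Finset.univ.filter fun p => p.1.2 = K) hX
    ?_ ?_ ?_ ?_
  · intro a b hab _ hb h
    simp only [Finset.mem_filter, Finset.mem_univ, true_and] at hb h ⊢
    rcases h with h | h
    · rcases hb with hb | ⟨p, rfl⟩
      · exact hb
      · exact absurd (hab.symm.trans h) (Fin.succAbove_ne K _)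
    · exact h
  · intro M
    refine wt_eq_iff (K := K) (t := 1) ?_ (fun j => ?_) (fun j => ?_)
    · rw [wt_extend_self hX, hK, Finset.filter_filter, Finset.filter_filter, card_filter_snd_fst]
      simp only [and_self, card_filter_snd, lt_irrefl, if_false]
      push_cast
      ring
    · rw [wt_extend_succAbove hX, Finset.filter_filter, Finset.filter_filter,
        card_filter_snd_fst, Finset.filter_false_of_mem fun p _ h =>
          Fin.succAbove_ne K j (h.2.symm.trans h.1)]
      rcases lt_or_gt_of_ne (Fin.succAbove_ne K j) with h | h
      · simp [h, h.not_gt]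
      · simp [h, h.not_gt]
    · rw [wdel_eq, sub_add_cancel]
  · intro M hM p hp
    rw [mem_iff_of_wt_eq_one (by rw [hM, hK]) hp]
    simp
  · rw [card_filter_snd]

/-- Lemma 2.4: if `w_K = n` then `⟦w⟧` is isomorphic to the weight summand of
`Λ^* nil_{n-1}` for the sequence with the `K`-th entry deleted, shifted up by `n - K`
(1-based `K`); if `w_K = 1` it is isomorphic to the summand of the deleted sequence with
all entries decreased by one, shifted up by `K - 1` (1-based `K`). -/
theorem delete_extreme_entry (n : ℕ) (w : Fin n → ℤ) (hw : Sn n w) (K : Fin n) :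
    ((w K = (n : ℤ)) →
      ∃ e : (d : ℤ) → Cw n d w ≃ₗ[ℤ] Cw (n - 1) (d - ((n : ℤ) - 1 - K.1)) (wdel w K),
        ∀ d : ℤ,
          (dW (n - 1) (d - ((n : ℤ) - 1 - K.1)) (wdel w K)) ∘ₗ
            (castCw (n - 1) (wdel w K)
              (by ring : d + 1 - ((n : ℤ) - 1 - K.1) = (d - ((n : ℤ) - 1 - K.1)) + 1)).toLinearMap ∘ₗ
            (e (d + 1)).toLinearMap =
          (e d).toLinearMap ∘ₗ dW n d w) ∧
    ((w K = 1) →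
      ∃ e : (d : ℤ) → Cw n d w ≃ₗ[ℤ] Cw (n - 1) (d - (K.1 : ℤ)) (fun i => wdel w K i - 1),
        ∀ d : ℤ,
          (dW (n - 1) (d - (K.1 : ℤ)) (fun i => wdel w K i - 1)) ∘ₗ
            (castCw (n - 1) (fun i => wdel w K i - 1)
              (by ring : d + 1 - (K.1 : ℤ) = (d - (K.1 : ℤ)) + 1)).toLinearMap ∘ₗ
            (e (d + 1)).toLinearMap =
          (e d).toLinearMap ∘ₗ dW n d w) := by
  cases n with
  | zero => exact K.elim0
  | succ m =>
    constructor
    · intro hK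
      obtain ⟨e, he⟩ := exists_equiv_of_eq_top w K hK rfl
      exact ⟨e, fun d => he d (by ring)⟩
    · intro hK
      obtain ⟨e, he⟩ := exists_equiv_of_eq_one w K hK
      exact ⟨e, fun d => he d (by ring)⟩

end Nil
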